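/- Let d ≥ 1, α ∈ (0,d), and ε ∈ (0,α]. There exists a constant C > 0 depending only on α, ε, and d such that for every measure μ ∈ ℳ^{d−α}(ℝ^d) for which I_α μ ∈ L¹(K; 𝓗^{d−α+ε}_∞) for every compact K ⊂ ℝ^d, one has ‖I_α μ‖_{BMO^{d−α+ε}(ℝ^d)} ≤ C ‖μ‖_{ℳ^{d−α}(ℝ^d)}, where the BMO^{d−α+ε} seminorm on ℝ^d is the supremum over all finite cubes Q ⊂ ℝ^d of inf_{c∈ℝ} l(Q)^{−(d−α+ε)} ∫_Q |I_α μ − c| d𝓗^{d−α+ε}_∞. -/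

import Mathlib

open Set MeasureTheory ENNReal NNReal Filter

noncomputable section

/-- `ℝ^d` with the Euclidean metric. -/
abbrev Euc (d : ℕ) : Type := EuclideanSpace ℝ (Fin d)

/-- An axis-parallel cube in `ℝ^d`, given by its lower corner and (positive) side length. -/
structure Cube (d : ℕ) where
  corner : Fin d → ℝ
  side : ℝ
  side_pos : 0 < side

namespace Cube

/-- The (half-open) set of points of the cube. -/
def set {d : ℕ} (Q : Cube d) : Set (Euc d) :=
  {x : Euc d | ∀ i, Q.corner i ≤ x i ∧ x i < Q.corner i + Q.side}

/-- The dyadic lattice `𝓓(Q)` generated by `Q`: all cubes of side `l(Q)·2ⁿ` (`n : ℤ`) with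
corners on the correspondingly rescaled grid anchored at the corner of `Q`; equivalently `Q`,
its dyadic ancestors, and all of their repeated dyadic subdivisions. -/
def dyadic {d : ℕ} (Q : Cube d) : Set (Cube d) :=
  {Q' | ∃ (n : ℤ) (k : Fin d → ℤ), Q'.side = Q.side * 2 ^ n ∧
    ∀ i, Q'.corner i = Q.corner i + (k i : ℝ) * (Q.side * 2 ^ n)}

end Cube

/-- The spherical Hausdorff content `𝓗^β_∞`, with `ω_β = π^{β/2}/Γ(β/2+1)`. -/
def hausdorffContent (d : ℕ) (β : ℝ) (E : Set (Euc d)) : ℝ≥0∞ :=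
  ⨅ (c : ℕ → Euc d × ℝ) (_ : E ⊆ ⋃ i, Metric.ball (c i).1 (c i).2),
    ∑' i, ENNReal.ofReal (Real.pi ^ (β / 2) / Real.Gamma (β / 2 + 1) * (c i).2 ^ β)

/-- The dyadic Hausdorff content `𝓗^{β,Q}_∞` adapted to the cube `Q`. -/
def dyadicContent (d : ℕ) (β : ℝ) (Q : Cube d) (E : Set (Euc d)) : ℝ≥0∞ :=
  ⨅ (c : ℕ → Cube d) (_ : ∀ i, c i ∈ Q.dyadic) (_ : E ⊆ ⋃ i, (c i).set),
    ∑' i, ENNReal.ofReal ((c i).side ^ β)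

/-- The Choquet integral `∫_A f dH := ∫_0^∞ H({x ∈ A : f x > t}) dt`. -/
def choquetIntegral {X : Type*} (H : Set X → ℝ≥0∞) (A : Set X) (f : X → ℝ) : ℝ≥0∞ :=
  ∫⁻ t in Set.Ioi (0 : ℝ), H {x | x ∈ A ∧ t < f x}

/-- `f` is `H`-quasicontinuous: for every `ε > 0` there is an open set `O` with `H O < ε`
such that `f` restricted to `Oᶜ` is continuous. -/
def QuasiContinuous {X : Type*} [TopologicalSpace X] (H : Set X → ℝ≥0∞) (f : X → ℝ) : Prop :=
  ∀ ε : ℝ, 0 < ε → ∃ O : Set X, IsOpen O ∧ H O < ENNReal.ofReal ε ∧ ContinuousOn f Oᶜ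

/-- `f ∈ L¹(A; H)`: `f` is `H`-quasicontinuous and `∫_A |f| dH < ∞`. -/
def MemChoquetL1 {X : Type*} [TopologicalSpace X] (H : Set X → ℝ≥0∞) (A : Set X)
    (f : X → ℝ) : Prop :=
  QuasiContinuous H f ∧ choquetIntegral H A (fun x => |f x|) < ⊤

/-- The `BMO^β(Q₀)` seminorm: `sup_{Q ⊆ Q₀} inf_{c ∈ ℝ} l(Q)^{-β} ∫_Q |u - c| d𝓗^β_∞`. -/
def bmoSeminorm (d : ℕ) (β : ℝ) (Q₀ : Set (Euc d)) (u : Euc d → ℝ) : ℝ≥0∞ :=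
  ⨆ (Q : Cube d) (_ : Q.set ⊆ Q₀),
    ⨅ c : ℝ, choquetIntegral (hausdorffContent d β) Q.set (fun x => |u x - c|) /
      ENNReal.ofReal (Q.side ^ β)

/-- Membership in `BMO^β(Q₀)`. -/
def MemBMO (d : ℕ) (β : ℝ) (Q₀ : Set (Euc d)) (u : Euc d → ℝ) : Prop :=
  MemChoquetL1 (hausdorffContent d β) Q₀ u ∧ bmoSeminorm d β Q₀ u < ⊤


/-- The classical John–Nirenberg BMO seminorm on `Q₀` with respect to Lebesgue measure. -/
def bmoClassical (d : ℕ) (Q₀ : Set (Euc d)) (u : Euc d → ℝ) : ℝ≥0∞ :=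
  ⨆ (Q : Cube d) (_ : Q.set ⊆ Q₀),
    (volume Q.set)⁻¹ * ∫⁻ x in Q.set, ENNReal.ofReal |u x - ⨍ y in Q.set, u y|

/-- The axis-parallel affine subspace of `ℝ^d` obtained by freeing the coordinates in `S`
and fixing the remaining coordinates to the values of `b`. -/
def hyperplane (d : ℕ) (S : Finset (Fin d)) (b : Fin d → ℝ) : Set (Euc d) :=
  {x : Euc d | ∀ i ∉ S, x i = b i}

/-- The classical BMO seminorm of `u` on `Q₀ ∩ H` with respect to the `k`-dimensional
Hausdorff measure `𝓗^k`, the supremum being over the subcubes `Q.set ∩ H ⊆ Q₀ ∩ H`. -/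
def bmoClassicalOnPlane (d k : ℕ) (Q₀ : Cube d) (H : Set (Euc d)) (u : Euc d → ℝ) : ℝ≥0∞ :=
  ⨆ (Q : Cube d) (_ : Q.set ∩ H ⊆ Q₀.set),
    (Measure.hausdorffMeasure (k : ℝ) (Q.set ∩ H))⁻¹ *
      ∫⁻ x in Q.set ∩ H,
        ENNReal.ofReal |u x - ⨍ y in Q.set ∩ H, u y ∂(Measure.hausdorffMeasure (k : ℝ))|
          ∂(Measure.hausdorffMeasure (k : ℝ))

/-- The unique dyadic cube of `𝓓(Q)` of generation `n` (side `l(Q)·2^{-n}`) containing `x`. -/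
def dyadicCubeAt {d : ℕ} (Q : Cube d) (n : ℕ) (x : Euc d) : Cube d where
  corner := fun i => Q.corner i + Q.side * (2 : ℝ)⁻¹ ^ n *
    (⌊(x i - Q.corner i) / (Q.side * (2 : ℝ)⁻¹ ^ n)⌋ : ℝ)
  side := Q.side * (2 : ℝ)⁻¹ ^ n
  side_pos := by have := Q.side_pos; positivity

/-- The dyadic `β`-Hausdorff maximal function associated to `𝓗^{β,Q}_∞`. -/
def dyadicMaximal (d : ℕ) (β : ℝ) (Q : Cube d) (f : Euc d → ℝ) (x : Euc d) : ℝ≥0∞ :=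
  ⨆ (Q' : Cube d) (_ : Q' ∈ Q.dyadic) (_ : x ∈ Q'.set),
    choquetIntegral (dyadicContent d β Q) Q'.set (fun y => |f y|) / ENNReal.ofReal (Q'.side ^ β)

/-- The `BMO^{β,p}(Q₀)` seminorm. -/
def bmoSeminormP (d : ℕ) (β p : ℝ) (Q₀ : Set (Euc d)) (u : Euc d → ℝ) : ℝ≥0∞ :=
  ⨆ (Q : Cube d) (_ : Q.set ⊆ Q₀),
    ⨅ c : ℝ, (choquetIntegral (hausdorffContent d β) Q.set (fun x => |u x - c| ^ p) /
      ENNReal.ofReal (Q.side ^ β)) ^ (1 / p)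

/-- The standard normalization constant `γ(α) = π^{d/2} 2^α Γ(α/2) / Γ((d-α)/2)`. -/
def rieszConst (d : ℕ) (α : ℝ) : ℝ :=
  Real.pi ^ ((d : ℝ) / 2) * 2 ^ α * Real.Gamma (α / 2) / Real.Gamma (((d : ℝ) - α) / 2)

/-- The Riesz potential `I_α μ (x) = γ(α)⁻¹ ∫ |x - y|^{α - d} dμ(y)`. -/
def rieszPotential (d : ℕ) (α : ℝ) (μ : Measure (Euc d)) (x : Euc d) : ℝ :=
  (rieszConst d α)⁻¹ * (∫⁻ y, ENNReal.ofReal (‖x - y‖ ^ (α - (d : ℝ))) ∂μ).toReal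

/-- The Morrey norm `‖μ‖_{ℳ^γ} = sup_{x, r>0} μ(B(x,r))/r^γ`. -/
def morreyNorm (d : ℕ) (γ : ℝ) (μ : Measure (Euc d)) : ℝ≥0∞ :=
  ⨆ (x : Euc d) (r : ℝ) (_ : 0 < r), μ (Metric.ball x r) / ENNReal.ofReal (r ^ γ)

/-- The dyadic `BMO^β_*(Q₀)` seminorm, where for each subcube `Q` the dyadic Hausdorff
content adapted to that `Q` is used. -/
def bmoDyadicSeminorm (d : ℕ) (β : ℝ) (Q₀ : Set (Euc d)) (u : Euc d → ℝ) : ℝ≥0∞ :=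
  ⨆ (Q : Cube d) (_ : Q.set ⊆ Q₀),
    ⨅ c : ℝ, choquetIntegral (dyadicContent d β Q) Q.set (fun x => |u x - c|) /
      ENNReal.ofReal (Q.side ^ β)

/-- A (possibly infinite) cube in `ℝ^d`: either a finite cube, or a product of intervals
which are infinite in every coordinate direction. -/
def IsGenCube (d : ℕ) (S : Set (Euc d)) : Prop :=
  (∃ Q : Cube d, S = Q.set) ∨
  (∃ I : Fin d → Set ℝ,
      (∀ i, (∃ a, I i = Set.Ici a) ∨ (∃ b, I i = Set.Iio b) ∨ I i = Set.univ) ∧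
      S = {x : Euc d | ∀ i, x i ∈ I i})

/-- The Choquet integral of an `ℝ≥0∞`-valued function. -/
def choquetIntegralE {X : Type*} (H : Set X → ℝ≥0∞) (f : X → ℝ≥0∞) : ℝ≥0∞ :=
  ∫⁻ t in Set.Ioi (0 : ℝ), H {x | ENNReal.ofReal t < f x}

/-- The constant `ω_β` in the definition of the Hausdorff content is positive. -/
lemma omega_pos {β : ℝ} (hβ : 0 < β) :
    0 < Real.pi ^ (β / 2) / Real.Gamma (β / 2 + 1) :=
  div_pos (Real.rpow_pos_of_pos Real.pi_pos _) (Real.Gamma_pos_of_pos (by linarith))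

lemma hausdorffContent_mono {d : ℕ} {β : ℝ} {E F : Set (Euc d)} (h : E ⊆ F) :
    hausdorffContent d β E ≤ hausdorffContent d β F :=
  le_iInf₂ fun c hc => iInf₂_le c (h.trans hc)

lemma hausdorffContent_le_tsum {d : ℕ} {β : ℝ} (hβ : 0 < β) {ι : Type*} [Countable ι]
    {E : Set (Euc d)} (x : ι → Euc d) (r : ι → ℝ) (h : E ⊆ ⋃ i, Metric.ball (x i) (r i)) :
    hausdorffContent d β E ≤
      ∑' i, ENNReal.ofReal (Real.pi ^ (β / 2) / Real.Gamma (β / 2 + 1) * r i ^ β) := by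
  obtain ⟨f, hf⟩ := exists_injective_nat ι
  refine (iInf₂_le (Function.extend f (fun i => (x i, r i)) fun _ => (0, 0)) ?_).trans ?_
  · intro y hy
    obtain ⟨i, hi⟩ := mem_iUnion.1 (h hy)
    exact mem_iUnion.2 ⟨f i, by simpa [hf.extend_apply] using hi⟩
  · rw [← tsum_extend_zero hf]
    refine ENNReal.tsum_le_tsum fun n => ?_
    rw [Function.apply_extend (fun z : Euc d × ℝ =>
      ENNReal.ofReal (Real.pi ^ (β / 2) / Real.Gamma (β / 2 + 1) * z.2 ^ β))]
    refine le_of_eq ?_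
    congr 1
    funext n
    simp [Real.zero_rpow hβ.ne']

lemma hausdorffContent_ball_le {d : ℕ} {β : ℝ} (hβ : 0 < β) (x : Euc d) (r : ℝ) :
    hausdorffContent d β (Metric.ball x r) ≤
      ENNReal.ofReal (Real.pi ^ (β / 2) / Real.Gamma (β / 2 + 1) * r ^ β) := by
  simpa using hausdorffContent_le_tsum hβ (ι := Unit) (fun _ => x) (fun _ => r)
    (E := Metric.ball x r) (subset_iUnion_of_subset () subset_rfl)

/-- A weak-type estimate for the content of a set all of whose points carry a ball
of large `μ`-measure. -/
lemma ofReal_mul_hausdorffContent_le {d : ℕ} {β : ℝ} (hβ : 0 < β) (μ : Measure (Euc d))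
    {E U : Set (Euc d)} (r : Euc d → ℝ) {ρ S : ℝ} (hS : 0 ≤ S)
    (hr : ∀ x ∈ E, 0 < r x ∧ r x ≤ ρ) (hU : ∀ x ∈ E, Metric.closedBall x (r x) ⊆ U)
    (hμ : ∀ x ∈ E, ENNReal.ofReal (S * r x ^ β) ≤ μ (Metric.closedBall x (r x))) :
    ENNReal.ofReal S * hausdorffContent d β E ≤
      ENNReal.ofReal (Real.pi ^ (β / 2) / Real.Gamma (β / 2 + 1) * 6 ^ β) * μ U := by
  obtain ⟨u, huE, hdisj, hcov⟩ := Vitali.exists_disjoint_subfamily_covering_enlargement_closedBall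
    E id r ρ (fun x hx => (hr x hx).2) 5 (by norm_num)
  simp only [id] at hdisj hcov
  have hu : u.Countable := hdisj.countable_of_nonempty_interior fun x hx =>
    ⟨x, Metric.ball_subset_interior_closedBall (Metric.mem_ball_self (hr x (huE hx)).1)⟩
  have := hu.to_subtype
  have hω := omega_pos hβ
  have hE : E ⊆ ⋃ i : u, Metric.ball (i : Euc d) (6 * r i) := by
    intro x hx
    obtain ⟨b, hb, hxb⟩ := hcov x hx
    have h1 := hxb (Metric.mem_closedBall_self (hr x hx).1.le)
    have h2 := (hr b (huE hb)).1
    exact mem_iUnion.2 ⟨⟨b, hb⟩, Metric.closedBall_subset_ball (by linarith) h1⟩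
  calc ENNReal.ofReal S * hausdorffContent d β E
      ≤ ENNReal.ofReal S * ∑' i : u, ENNReal.ofReal
          (Real.pi ^ (β / 2) / Real.Gamma (β / 2 + 1) * (6 * r i) ^ β) := by
        gcongr
        exact hausdorffContent_le_tsum hβ (fun i : u => (i : Euc d)) (fun i => 6 * r i) hE
    _ = ∑' i : u, ENNReal.ofReal (Real.pi ^ (β / 2) / Real.Gamma (β / 2 + 1) * 6 ^ β) *
          ENNReal.ofReal (S * r i ^ β) := by
        rw [← ENNReal.tsum_mul_left]
        refine tsum_congr fun i => ?_
        rw [← ENNReal.ofReal_mul hS, ← ENNReal.ofReal_mul (by positivity),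
          Real.mul_rpow (by norm_num) (hr i (huE i.2)).1.le]
        ring_nf
    _ ≤ ∑' i : u, ENNReal.ofReal (Real.pi ^ (β / 2) / Real.Gamma (β / 2 + 1) * 6 ^ β) *
          μ (Metric.closedBall (i : Euc d) (r i)) := by
        gcongr with i
        exact hμ i (huE i.2)
    _ = ENNReal.ofReal (Real.pi ^ (β / 2) / Real.Gamma (β / 2 + 1) * 6 ^ β) *
          μ (⋃ i ∈ u, Metric.closedBall i (r i)) := by
        rw [ENNReal.tsum_mul_left,
          measure_biUnion hu hdisj fun _ _ => Metric.isClosed_closedBall.measurableSet]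
    _ ≤ _ := by
        gcongr
        exact iUnion₂_subset fun i hi => hU i (huE hi)

lemma lintegral_Ioi_le_of_le_div_sq {F : ℝ → ℝ≥0∞} {A B T : ℝ} (hA : 0 ≤ A) (hB : 0 ≤ B)
    (hT : 0 < T) (h1 : ∀ t, F t ≤ ENNReal.ofReal A)
    (h2 : ∀ t, T < t → F t ≤ ENNReal.ofReal (B / t ^ 2)) :
    ∫⁻ t in Ioi (0 : ℝ), F t ≤ ENNReal.ofReal (A * T + B / T) := by
  rw [← Ioc_union_Ioi_eq_Ioi hT.le, ENNReal.ofReal_add (by positivity) (by positivity)]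
  refine (lintegral_union_le _ _ _).trans (add_le_add ?_ ?_)
  · calc ∫⁻ t in Ioc 0 T, F t ≤ ∫⁻ _ in Ioc 0 T, ENNReal.ofReal A := lintegral_mono h1
      _ = ENNReal.ofReal (A * T) := by
        simp [ENNReal.ofReal_mul hA]
  · have hint : IntegrableOn (fun t : ℝ => B * t ^ (-2 : ℝ)) (Ioi T) :=
      (integrableOn_Ioi_rpow_of_lt (by norm_num) hT).const_mul B
    calc ∫⁻ t in Ioi T, F t ≤ ∫⁻ t in Ioi T, ENNReal.ofReal (B * t ^ (-2 : ℝ)) := by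
          refine setLIntegral_mono' measurableSet_Ioi fun t ht => (h2 t ht).trans_eq ?_
          rw [Real.rpow_neg (hT.trans ht).le, div_eq_mul_inv]
          norm_num
      _ = ENNReal.ofReal (B / T) := by
        rw [← ofReal_integral_eq_lintegral_ofReal hint, integral_const_mul,
          integral_Ioi_rpow_of_lt (by norm_num) hT]
        · norm_num [Real.rpow_neg_one, div_eq_mul_inv]
        · filter_upwards [ae_restrict_mem measurableSet_Ioi] with t ht
          have : 0 < t := hT.trans ht
          positivity

lemma rpow_neg_le_add {n : ℕ} {p a b s ρ : ℝ} (hp : 0 < p) (hpn : p ≤ n) (hs : 0 < s)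
    (ha : s / 2 ≤ a) (hb : 0 < b) (hab : s ≤ max a b) (hρ : b - a ≤ ρ) (hρ0 : 0 ≤ ρ) :
    a ^ (-p) ≤ b ^ (-p) + n * 2 ^ p * ρ * s ^ (-p - 1) := by
  have ha0 : 0 < a := by linarith
  rcases le_total b a with h | h
  · have h1 : a ^ (-p) ≤ b ^ (-p) := Real.rpow_le_rpow_of_nonpos hb h (by linarith)
    have : 0 ≤ n * 2 ^ p * ρ * s ^ (-p - 1) := by positivity
    linarith
  · rw [max_eq_right h] at hab
    have hz0 : 0 < a / b := by positivity
    have hz1 : a / b ≤ 1 := (div_le_one hb).2 h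
    have h1 : 1 - n * ((b - a) / b) ≤ (a / b) ^ p := by
      have h2 := one_add_mul_le_pow (a := a / b - 1) (by linarith) n
      have h3 : (a / b) ^ n ≤ (a / b) ^ p := by
        rw [← Real.rpow_natCast]
        exact Real.rpow_le_rpow_of_exponent_ge hz0 hz1 hpn
      have h4 : (b - a) / b = 1 - a / b := by field_simp
      rw [h4]
      simp only [add_sub_cancel] at h2
      linarith
    have h2 : b ^ (-p) = a ^ (-p) * (a / b) ^ p := by
      rw [Real.div_rpow ha0.le hb.le, Real.rpow_neg ha0.le, Real.rpow_neg hb.le]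
      field_simp
    have h3 : a ^ (-p) ≤ 2 ^ p * s ^ (-p) := by
      have : a ^ (-p) ≤ (s / 2) ^ (-p) :=
        Real.rpow_le_rpow_of_nonpos (by positivity) ha (by linarith)
      rw [Real.div_rpow hs.le (by norm_num), Real.rpow_neg (by norm_num : (0 : ℝ) ≤ 2)] at this
      rw [div_inv_eq_mul] at this
      linarith
    have h4 : (b - a) / b ≤ ρ / s := by gcongr
    have h5 : a ^ (-p) * (n * ((b - a) / b)) ≤ 2 ^ p * s ^ (-p) * (n * (ρ / s)) := by
      have : 0 ≤ (b - a) / b := div_nonneg (by linarith) hb.le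
      gcongr
    have h6 : s ^ (-p - 1) = s ^ (-p) / s := by rw [Real.rpow_sub hs, Real.rpow_one]
    have h7 : a ^ (-p) * (1 - n * ((b - a) / b)) ≤ a ^ (-p) * (a / b) ^ p := by gcongr
    rw [h6, h2]
    calc a ^ (-p) ≤ a ^ (-p) * (a / b) ^ p + a ^ (-p) * (n * ((b - a) / b)) := by linarith
      _ ≤ a ^ (-p) * (a / b) ^ p + 2 ^ p * s ^ (-p) * (n * (ρ / s)) := by linarith
      _ = _ := by ring

/-- The Riesz energy of the far part of a Morrey measure, with one extra order of decay. -/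
lemma lintegral_compl_ball_le {d : ℕ} {p m R : ℝ} (hp : 0 < p) (hm : 0 ≤ m) (hR : 0 < R)
    (μ : Measure (Euc d)) (x : Euc d)
    (hμ : ∀ r, 0 < r → μ (Metric.ball x r) ≤ ENNReal.ofReal (m * r ^ p)) :
    ∫⁻ y in (Metric.ball x R)ᶜ, ENNReal.ofReal (‖x - y‖ ^ (-p - 1)) ∂μ ≤
      ENNReal.ofReal (2 ^ (p + 1) * m / R) := by
  have hmeas : ∀ k : ℕ, MeasurableSet (Metric.ball x (R * 2 ^ (k + 1))) := fun k =>
    Metric.isOpen_ball.measurableSet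
  calc ∫⁻ y in (Metric.ball x R)ᶜ, ENNReal.ofReal (‖x - y‖ ^ (-p - 1)) ∂μ
      ≤ ∫⁻ y in (Metric.ball x R)ᶜ, ∑' k : ℕ, (Metric.ball x (R * 2 ^ (k + 1))).indicator
          (fun _ => ENNReal.ofReal ((R * 2 ^ k) ^ (-p - 1))) y ∂μ := by
        refine setLIntegral_mono' Metric.isOpen_ball.measurableSet.compl fun y hy => ?_
        have hy' : R ≤ ‖x - y‖ := by
          simpa [Metric.mem_ball, dist_eq_norm, norm_sub_rev] using hy
        obtain ⟨k, hk1, hk2⟩ := exists_nat_pow_near ((one_le_div hR).2 hy') one_lt_two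
        rw [le_div_iff₀ hR] at hk1
        rw [div_lt_iff₀ hR] at hk2
        refine le_trans ?_ (ENNReal.le_tsum k)
        have hmem : y ∈ Metric.ball x (R * 2 ^ (k + 1)) := by
          rw [Metric.mem_ball', dist_eq_norm]
          linarith
        rw [indicator_of_mem hmem]
        exact ENNReal.ofReal_le_ofReal
          (Real.rpow_le_rpow_of_nonpos (by positivity) (by linarith) (by linarith))
    _ ≤ ∫⁻ y, ∑' k : ℕ, (Metric.ball x (R * 2 ^ (k + 1))).indicator
          (fun _ => ENNReal.ofReal ((R * 2 ^ k) ^ (-p - 1))) y ∂μ :=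
        setLIntegral_le_lintegral _ _
    _ = ∑' k : ℕ, ENNReal.ofReal ((R * 2 ^ k) ^ (-p - 1)) *
          μ (Metric.ball x (R * 2 ^ (k + 1))) := by
        rw [lintegral_tsum fun k => (measurable_const.indicator (hmeas k)).aemeasurable]
        simp only [lintegral_indicator_const (hmeas _)]
    _ ≤ ∑' k : ℕ, ENNReal.ofReal (2 ^ p * m / R * (1 / 2) ^ k) := by
        refine ENNReal.tsum_le_tsum fun k => ?_
        refine (mul_le_mul_right (hμ _ (by positivity)) _).trans_eq ?_
        rw [← ENNReal.ofReal_mul (by positivity)]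
        congr 1
        have h1 : R * 2 ^ (k + 1) = 2 * (R * 2 ^ k) := by ring
        have h2 : (0 : ℝ) < R * 2 ^ k := by positivity
        rw [h1, Real.mul_rpow (by norm_num) h2.le, Real.rpow_sub h2, Real.rpow_neg h2.le,
          Real.rpow_one, one_div, inv_pow]
        field_simp
    _ = ENNReal.ofReal (2 ^ (p + 1) * m / R) := by
        rw [← ENNReal.ofReal_tsum_of_nonneg (fun k => by positivity)
          (summable_geometric_two.mul_left _), _root_.tsum_mul_left, tsum_geometric_two,
          Real.rpow_add_one (by norm_num)]
        congr 1
        ring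

lemma lintegral_ball_le_tsum {d : ℕ} {p R : ℝ} (hp : 0 < p) (hR : 0 < R)
    (μ : Measure (Euc d)) (x : Euc d) :
    ∫⁻ y in Metric.ball x R, ENNReal.ofReal (‖x - y‖ ^ (-p)) ∂μ ≤
      ∑' k : ℕ, ENNReal.ofReal (2 ^ p * (R * (1 / 2) ^ k) ^ (-p)) *
        μ (Metric.closedBall x (R * (1 / 2) ^ k)) := by
  have hmeas : ∀ k : ℕ, MeasurableSet (Metric.closedBall x (R * (1 / 2) ^ k)) := fun k =>
    Metric.isClosed_closedBall.measurableSet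
  calc ∫⁻ y in Metric.ball x R, ENNReal.ofReal (‖x - y‖ ^ (-p)) ∂μ
      ≤ ∫⁻ y in Metric.ball x R, ∑' k : ℕ, (Metric.closedBall x (R * (1 / 2) ^ k)).indicator
          (fun _ => ENNReal.ofReal (2 ^ p * (R * (1 / 2) ^ k) ^ (-p))) y ∂μ := by
        refine setLIntegral_mono' Metric.isOpen_ball.measurableSet fun y hy => ?_
        have hy' : ‖x - y‖ < R := by rwa [Metric.mem_ball', dist_eq_norm] at hy
        rcases (norm_nonneg (x - y)).eq_or_lt with h0 | h0
        · rw [← h0, Real.zero_rpow (by linarith)]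
          simp
        obtain ⟨k, hk1, hk2⟩ := exists_nat_pow_near_of_lt_one (div_pos h0 hR)
          ((div_le_one hR).2 hy'.le) (y := 1 / 2) (by norm_num) (by norm_num)
        rw [lt_div_iff₀ hR] at hk1
        rw [div_le_iff₀ hR] at hk2
        refine le_trans ?_ (ENNReal.le_tsum k)
        have hmem : y ∈ Metric.closedBall x (R * (1 / 2) ^ k) := by
          rw [Metric.mem_closedBall', dist_eq_norm]
          linarith
        rw [indicator_of_mem hmem]
        refine ENNReal.ofReal_le_ofReal ?_
        have h1 : ‖x - y‖ ^ (-p) ≤ (1 / 2 * (R * (1 / 2) ^ k)) ^ (-p) :=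
          Real.rpow_le_rpow_of_nonpos (by positivity) (by rw [pow_succ] at hk1; linarith)
            (by linarith)
        rw [Real.mul_rpow (by norm_num) (by positivity)] at h1
        refine h1.trans_eq ?_
        rw [one_div, Real.inv_rpow (by norm_num), ← Real.rpow_neg (by norm_num), neg_neg]
    _ ≤ ∫⁻ y, ∑' k : ℕ, (Metric.closedBall x (R * (1 / 2) ^ k)).indicator
          (fun _ => ENNReal.ofReal (2 ^ p * (R * (1 / 2) ^ k) ^ (-p))) y ∂μ :=
        setLIntegral_le_lintegral _ _
    _ = _ := by
        rw [lintegral_tsum fun k => (measurable_const.indicator (hmeas k)).aemeasurable]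
        simp only [lintegral_indicator_const (hmeas _)]

/-- The constant in the level-set estimate for local Riesz potentials of Morrey measures. -/
def levelConst (p ε : ℝ) : ℝ :=
  Real.pi ^ ((p + ε) / 2) / Real.Gamma ((p + ε) / 2 + 1) * 6 ^ (p + ε) * 2 ^ p /
    ((1 - (1 / 2) ^ (ε / 2)) / 2 ^ p) ^ 2

lemma half_rpow_lt_one {ε : ℝ} (hε : 0 < ε) : ((1 : ℝ) / 2) ^ (ε / 2) < 1 :=
  Real.rpow_lt_one (by norm_num) (by norm_num) (by linarith)

lemma levelConst_pos {p ε : ℝ} (hp : 0 < p) (hε : 0 < ε) : 0 < levelConst p ε := by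
  have h1 := omega_pos (add_pos hp hε)
  have h2 : (0 : ℝ) < 1 - (1 / 2) ^ (ε / 2) := sub_pos.2 (half_rpow_lt_one hε)
  unfold levelConst
  positivity

lemma exists_radius_of_lt_potential {d : ℕ} {p ε R t : ℝ} (hp : 0 < p) (hε : 0 < ε)
    (hR : 0 < R) (ht : 0 < t) (μ : Measure (Euc d)) (x : Euc d)
    (hx : ENNReal.ofReal t < ∫⁻ y in Metric.ball x R, ENNReal.ofReal (‖x - y‖ ^ (-p)) ∂μ) :
    ∃ k : ℕ, ENNReal.ofReal ((1 - (1 / 2) ^ (ε / 2)) / 2 ^ p * t * ((1 / 2) ^ (ε / 2)) ^ k *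
      (R * (1 / 2) ^ k) ^ p) ≤ μ (Metric.closedBall x (R * (1 / 2) ^ k)) := by
  by_contra! hcon
  set q : ℝ := (1 / 2) ^ (ε / 2) with hq
  have hq0 : 0 < q := by positivity
  have hq1 : q < 1 := half_rpow_lt_one hε
  have hq2 : 0 < 1 - q := sub_pos.2 hq1
  refine absurd (hx.trans_le (lintegral_ball_le_tsum hp hR μ x)) (not_lt.2 ?_)
  calc ∑' k : ℕ, ENNReal.ofReal (2 ^ p * (R * (1 / 2) ^ k) ^ (-p)) *
        μ (Metric.closedBall x (R * (1 / 2) ^ k))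
      ≤ ∑' k : ℕ, ENNReal.ofReal ((1 - q) * t * q ^ k) := by
        refine ENNReal.tsum_le_tsum fun k => ?_
        refine (mul_le_mul_right (hcon k).le _).trans_eq ?_
        rw [← ENNReal.ofReal_mul (by positivity)]
        congr 1
        have hr : 0 < R * (1 / 2) ^ k := by positivity
        rw [Real.rpow_neg hr.le]
        have := (Real.rpow_pos_of_pos hr p).ne'
        field_simp
    _ = ENNReal.ofReal t := by
        rw [← ENNReal.ofReal_tsum_of_nonneg (fun k => by positivity)
          ((summable_geometric_of_lt_one hq0.le hq1).mul_left _), _root_.tsum_mul_left,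
          tsum_geometric_of_lt_one hq0.le hq1]
        congr 1
        field_simp

lemma hausdorffContent_level_le {d : ℕ} {p ε m R t : ℝ} (hp : 0 < p) (hε : 0 < ε) (hm : 0 < m)
    (hR : 0 < R) (ht : 0 < t) (μ : Measure (Euc d)) (x₀ : Euc d)
    (hμ : ∀ x r, 0 < r → μ (Metric.closedBall x r) ≤ ENNReal.ofReal (m * r ^ p)) :
    hausdorffContent d (p + ε) {x | x ∈ Metric.ball x₀ R ∧
        ENNReal.ofReal t < ∫⁻ y in Metric.ball x R, ENNReal.ofReal (‖x - y‖ ^ (-p)) ∂μ} ≤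
      ENNReal.ofReal (levelConst p ε * R ^ (p + ε) * m ^ 2 / t ^ 2) := by
  set E := {x | x ∈ Metric.ball x₀ R ∧
        ENNReal.ofReal t < ∫⁻ y in Metric.ball x R, ENNReal.ofReal (‖x - y‖ ^ (-p)) ∂μ}
  set q : ℝ := (1 / 2) ^ (ε / 2) with hq
  have hq0 : 0 < q := by positivity
  have hq2 : 0 < 1 - q := sub_pos.2 (half_rpow_lt_one hε)
  set κ : ℝ := (1 - q) / 2 ^ p with hκ
  have hκ0 : 0 < κ := by positivity
  have key : ∀ x ∈ E, ∃ k : ℕ, ENNReal.ofReal (κ * t * q ^ k * (R * (1 / 2) ^ k) ^ p) ≤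
      μ (Metric.closedBall x (R * (1 / 2) ^ k)) := fun x hx =>
    exists_radius_of_lt_potential hp hε hR ht μ x hx.2
  choose! k hk using key
  have hle : ∀ x, R * (1 / 2) ^ k x ≤ R := fun x =>
    mul_le_of_le_one_right hR.le (pow_le_one₀ (by norm_num) (by norm_num))
  set S : ℝ := (κ * t) ^ 2 / (m * R ^ ε) with hS
  have hS0 : 0 < S := by positivity
  have hmain := ofReal_mul_hausdorffContent_le (add_pos hp hε) μ (E := E)
    (U := Metric.closedBall x₀ (2 * R)) (fun x => R * (1 / 2) ^ k x) (ρ := R) hS0.le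
    (fun x _ => ⟨by positivity, hle x⟩) ?_ ?_
  · have hU := hμ x₀ (2 * R) (by positivity)
    have hω := omega_pos (add_pos hp hε)
    have h1 := hmain.trans (mul_le_mul_right hU _)
    rw [← ENNReal.ofReal_mul (by positivity), mul_comm,
      ← ENNReal.le_div_iff_mul_le (Or.inl (ENNReal.ofReal_pos.2 hS0).ne')
        (Or.inl ENNReal.ofReal_ne_top), ← ENNReal.ofReal_div_of_pos hS0] at h1
    refine h1.trans_eq ?_
    congr 1
    rw [hS, levelConst, ← hq, ← hκ, Real.mul_rpow (by norm_num) hR.le, Real.rpow_add hR]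
    field_simp
  · intro x hx
    refine Metric.closedBall_subset_closedBall' ?_
    have := Metric.mem_ball.1 hx.1
    linarith [hle x]
  · intro x hx
    refine le_trans (ENNReal.ofReal_le_ofReal ?_) (hk x hx)
    have hr : 0 < R * (1 / 2) ^ k x := by positivity
    have h1 := (hk x hx).trans (hμ x _ hr)
    rw [ENNReal.ofReal_le_ofReal_iff (by positivity)] at h1
    have h2 : κ * t * q ^ k x ≤ m := le_of_mul_le_mul_right h1 (Real.rpow_pos_of_pos hr p)
    have h3 : (R * (1 / 2) ^ k x) ^ ε = R ^ ε * (q ^ k x * q ^ k x) := by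
      rw [Real.mul_rpow hR.le (by positivity), ← mul_pow, hq,
        ← Real.rpow_add (by norm_num : (0 : ℝ) < 1 / 2), add_halves, ← Real.rpow_natCast,
        ← Real.rpow_natCast, ← Real.rpow_mul (by norm_num), ← Real.rpow_mul (by norm_num),
        mul_comm ε]
    rw [Real.rpow_add hr, h3, hS]
    have h4 : (κ * t) ^ 2 / (m * R ^ ε) *
        ((R * (1 / 2) ^ k x) ^ p * (R ^ ε * (q ^ k x * q ^ k x))) =
        κ * t * q ^ k x * (R * (1 / 2) ^ k x) ^ p * ((κ * t * q ^ k x) / m) := by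
      have := (Real.rpow_pos_of_pos hR ε).ne'
      field_simp
    rw [h4]
    exact mul_le_of_le_one_right (by positivity) ((div_le_one hm).2 h2)

lemma lintegral_compl_ball_le_add {d : ℕ} {p m ρ : ℝ} (hp : 0 < p) (hpd : p ≤ d) (hm : 0 ≤ m)
    (hρ : 0 < ρ) (μ : Measure (Euc d)) (x₀ a b : Euc d) (ha : ‖a - x₀‖ ≤ ρ) (hb : ‖b - x₀‖ ≤ ρ)
    (hab : a = x₀ ∨ b = x₀)
    (hμ : ∀ r, 0 < r → μ (Metric.ball x₀ r) ≤ ENNReal.ofReal (m * r ^ p)) :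
    ∫⁻ y in (Metric.ball x₀ (2 * ρ))ᶜ, ENNReal.ofReal (‖a - y‖ ^ (-p)) ∂μ ≤
      ∫⁻ y in (Metric.ball x₀ (2 * ρ))ᶜ, ENNReal.ofReal (‖b - y‖ ^ (-p)) ∂μ +
        ENNReal.ofReal (d * 2 ^ p * 2 ^ p * m) := by
  have hba : ‖b - a‖ ≤ ρ := by
    rcases hab with rfl | rfl
    · exact hb
    · rwa [norm_sub_rev]
  calc ∫⁻ y in (Metric.ball x₀ (2 * ρ))ᶜ, ENNReal.ofReal (‖a - y‖ ^ (-p)) ∂μ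
      ≤ ∫⁻ y in (Metric.ball x₀ (2 * ρ))ᶜ, (ENNReal.ofReal (‖b - y‖ ^ (-p)) +
          ENNReal.ofReal (d * 2 ^ p * ρ) * ENNReal.ofReal (‖x₀ - y‖ ^ (-p - 1))) ∂μ := by
        refine setLIntegral_mono' Metric.isOpen_ball.measurableSet.compl fun y hy => ?_
        have hs : 2 * ρ ≤ ‖x₀ - y‖ := by
          simpa [Metric.mem_ball, dist_eq_norm, norm_sub_rev] using hy
        have h1 : ‖x₀ - y‖ ≤ ‖a - x₀‖ + ‖a - y‖ := by
          simpa [norm_sub_rev] using norm_sub_le_norm_sub_add_norm_sub x₀ a y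
        have h2 : ‖x₀ - y‖ ≤ ‖b - x₀‖ + ‖b - y‖ := by
          simpa [norm_sub_rev] using norm_sub_le_norm_sub_add_norm_sub x₀ b y
        have h3 : ‖b - y‖ ≤ ‖b - a‖ + ‖a - y‖ := norm_sub_le_norm_sub_add_norm_sub b a y
        rw [← ENNReal.ofReal_mul (by positivity),
          ← ENNReal.ofReal_add (by positivity) (by positivity)]
        refine ENNReal.ofReal_le_ofReal (rpow_neg_le_add hp hpd (by linarith) (by linarith)
          (by linarith) ?_ (by linarith) hρ.le)
        rcases hab with rfl | rfl
        · exact le_max_left _ _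
        · exact le_max_right _ _
    _ = ∫⁻ y in (Metric.ball x₀ (2 * ρ))ᶜ, ENNReal.ofReal (‖b - y‖ ^ (-p)) ∂μ +
          ENNReal.ofReal (d * 2 ^ p * ρ) * ∫⁻ y in (Metric.ball x₀ (2 * ρ))ᶜ,
            ENNReal.ofReal (‖x₀ - y‖ ^ (-p - 1)) ∂μ := by
        rw [lintegral_add_left (by fun_prop), lintegral_const_mul _ (by fun_prop)]
    _ ≤ _ := by
        gcongr
        refine (mul_le_mul_right
          (lintegral_compl_ball_le hp hm (by positivity) μ x₀ hμ) _).trans_eq ?_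
        rw [← ENNReal.ofReal_mul (by positivity), Real.rpow_add_one (by norm_num)]
        congr 1
        field_simp

lemma ofReal_abs_toReal_sub_le {I₁ I₂ c E : ℝ≥0∞} (hE : E ≠ ⊤) (h1 : I₂ ≤ c + E)
    (h2 : c ≤ I₂ + E) : ENNReal.ofReal |(I₁ + I₂).toReal - c.toReal| ≤ I₁ + E := by
  rcases eq_or_ne I₁ ⊤ with hI₁ | hI₁
  · simp [hI₁]
  rcases eq_or_ne c ⊤ with hc | hc
  · have hI₂ : I₂ = ⊤ := by
      by_contra h
      exact (ENNReal.add_ne_top.2 ⟨h, hE⟩) (top_unique (hc ▸ h2))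
    simp [hc, hI₂]
  have hI₂ : I₂ ≠ ⊤ := ne_top_of_le_ne_top (ENNReal.add_ne_top.2 ⟨hc, hE⟩) h1
  rw [ENNReal.ofReal_le_iff_le_toReal (ENNReal.add_ne_top.2 ⟨hI₁, hE⟩),
    ENNReal.toReal_add hI₁ hI₂, ENNReal.toReal_add hI₁ hE, abs_le]
  have h3 := ENNReal.toReal_mono (ENNReal.add_ne_top.2 ⟨hc, hE⟩) h1
  have h4 := ENNReal.toReal_mono (ENNReal.add_ne_top.2 ⟨hI₂, hE⟩) h2
  rw [ENNReal.toReal_add hc hE] at h3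
  rw [ENNReal.toReal_add hI₂ hE] at h4
  have := ENNReal.toReal_nonneg (a := I₁)
  constructor <;> linarith

lemma rieszConst_pos {d : ℕ} {α : ℝ} (hα : 0 < α) (hαd : α < d) : 0 < rieszConst d α := by
  have h1 := Real.Gamma_pos_of_pos (show 0 < α / 2 by linarith)
  have h2 := Real.Gamma_pos_of_pos (show 0 < ((d : ℝ) - α) / 2 by linarith)
  have := Real.pi_pos
  unfold rieszConst
  positivity

/-- Pointwise oscillation of a Riesz potential: up to an additive constant it is controlled
by its local part. -/
lemma abs_rieszPotential_sub_le {d : ℕ} {α m ρ : ℝ} (hα : 0 < α) (hαd : α < d) (hm : 0 ≤ m)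
    (hρ : 0 < ρ) (μ : Measure (Euc d)) (x₀ : Euc d)
    (hμ : ∀ r, 0 < r → μ (Metric.ball x₀ r) ≤ ENNReal.ofReal (m * r ^ ((d : ℝ) - α))) :
    ∃ c : ℝ, ∀ x, ‖x - x₀‖ ≤ ρ → ENNReal.ofReal (rieszConst d α * |rieszPotential d α μ x - c|) ≤
      ∫⁻ y in Metric.ball x (4 * ρ), ENNReal.ofReal (‖x - y‖ ^ (-((d : ℝ) - α))) ∂μ +
        ENNReal.ofReal (d * 2 ^ ((d : ℝ) - α) * 2 ^ ((d : ℝ) - α) * m) := by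
  have hp : 0 < (d : ℝ) - α := sub_pos.2 hαd
  have hpd : (d : ℝ) - α ≤ d := by linarith
  have hγ := rieszConst_pos hα hαd
  refine ⟨(rieszConst d α)⁻¹ * (∫⁻ y in (Metric.ball x₀ (2 * ρ))ᶜ,
    ENNReal.ofReal (‖x₀ - y‖ ^ (-((d : ℝ) - α))) ∂μ).toReal, fun x hx => ?_⟩
  have h0 : ‖x₀ - x₀‖ ≤ ρ := by simpa using hρ.le
  have h := ofReal_abs_toReal_sub_le
    (I₁ := ∫⁻ y in Metric.ball x₀ (2 * ρ), ENNReal.ofReal (‖x - y‖ ^ (-((d : ℝ) - α))) ∂μ)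
    ENNReal.ofReal_ne_top
    (lintegral_compl_ball_le_add hp hpd hm hρ μ x₀ x x₀ hx h0 (Or.inr rfl) hμ)
    (lintegral_compl_ball_le_add hp hpd hm hρ μ x₀ x₀ x h0 hx (Or.inl rfl) hμ)
  rw [lintegral_add_compl _ Metric.isOpen_ball.measurableSet] at h
  have hsub : Metric.ball x₀ (2 * ρ) ⊆ Metric.ball x (4 * ρ) := by
    refine Metric.ball_subset_ball' ?_
    rw [dist_comm, dist_eq_norm]
    linarith
  have heq : rieszConst d α * |rieszPotential d α μ x - (rieszConst d α)⁻¹ *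
      (∫⁻ y in (Metric.ball x₀ (2 * ρ))ᶜ,
        ENNReal.ofReal (‖x₀ - y‖ ^ (-((d : ℝ) - α))) ∂μ).toReal| =
      |(∫⁻ y, ENNReal.ofReal (‖x - y‖ ^ (-((d : ℝ) - α))) ∂μ).toReal -
        (∫⁻ y in (Metric.ball x₀ (2 * ρ))ᶜ,
          ENNReal.ofReal (‖x₀ - y‖ ^ (-((d : ℝ) - α))) ∂μ).toReal| := by
    rw [rieszPotential, ← mul_sub, abs_mul, abs_of_pos (inv_pos.2 hγ),
      mul_inv_cancel_left₀ hγ.ne', neg_sub]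
  rw [heq]
  refine h.trans ?_
  gcongr

lemma Cube.norm_sub_corner_le {d : ℕ} (Q : Cube d) {x : Euc d} (hx : x ∈ Q.set) :
    ‖x - WithLp.toLp 2 Q.corner‖ ≤ d * Q.side := by
  have hl := Q.side_pos
  rw [EuclideanSpace.norm_eq]
  refine Real.sqrt_le_iff.2 ⟨by positivity, ?_⟩
  calc ∑ i, ‖(x - WithLp.toLp 2 Q.corner) i‖ ^ 2 ≤ ∑ _i : Fin d, Q.side ^ 2 := by
        refine Finset.sum_le_sum fun i _ => ?_
        have := hx i
        gcongr
        rw [Real.norm_eq_abs, abs_le]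
        simp only [PiLp.sub_apply]
        constructor <;> linarith
    _ = d * Q.side ^ 2 := by simp
    _ ≤ (d * Q.side) ^ 2 := by
        rw [mul_pow]
        gcongr
        exact_mod_cast Nat.le_self_pow two_ne_zero d

lemma measure_ball_le_of_morreyNorm_le {d : ℕ} {p m : ℝ} (hm : 0 ≤ m) {μ : Measure (Euc d)}
    (h : morreyNorm d p μ ≤ ENNReal.ofReal m) (x : Euc d) {r : ℝ} (hr : 0 < r) :
    μ (Metric.ball x r) ≤ ENNReal.ofReal (m * r ^ p) := by
  have hrp := Real.rpow_pos_of_pos hr p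
  have h1 : μ (Metric.ball x r) / ENNReal.ofReal (r ^ p) ≤ ENNReal.ofReal m :=
    (le_iSup₂_of_le x r (le_iSup (fun _ : 0 < r => _) hr)).trans h
  rwa [ENNReal.div_le_iff (ENNReal.ofReal_pos.2 hrp).ne' ENNReal.ofReal_ne_top,
    ← ENNReal.ofReal_mul hm] at h1

lemma measure_closedBall_le_of_morreyNorm_le {d : ℕ} {p m : ℝ} (hm : 0 ≤ m)
    {μ : Measure (Euc d)} (h : morreyNorm d p μ ≤ ENNReal.ofReal m) (x : Euc d) {r : ℝ}
    (hr : 0 < r) : μ (Metric.closedBall x r) ≤ ENNReal.ofReal (2 ^ p * m * r ^ p) := by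
  refine (measure_mono (Metric.closedBall_subset_ball (by linarith : r < 2 * r))).trans
    ((measure_ball_le_of_morreyNorm_le hm h x (by positivity)).trans_eq ?_)
  rw [Real.mul_rpow (by norm_num) hr.le]
  ring_nf

/-- The constant in the Morrey–`BMO` estimate for Riesz potentials. -/
def rieszBMOConst (d : ℕ) (α ε : ℝ) : ℝ :=
  let p := (d : ℝ) - α
  let e := 2 * (rieszConst d α)⁻¹ * (d * 2 ^ p * 2 ^ p)
  (4 * d) ^ (p + ε) * (Real.pi ^ ((p + ε) / 2) / Real.Gamma ((p + ε) / 2 + 1) * e +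
    levelConst p ε * (2 ^ p) ^ 2 * (2 * (rieszConst d α)⁻¹) ^ 2 / e)

lemma rieszBMOConst_pos {d : ℕ} {α ε : ℝ} (hd : 1 ≤ d) (hα : 0 < α) (hαd : α < d) (hε : 0 < ε) :
    0 < rieszBMOConst d α ε := by
  have hp : 0 < (d : ℝ) - α := sub_pos.2 hαd
  have hd' : (0 : ℝ) < d := by exact_mod_cast hd
  have h1 := rieszConst_pos hα hαd
  have h2 := omega_pos (add_pos hp hε)
  have h3 := levelConst_pos hp hε
  unfold rieszBMOConst
  positivity

lemma bmoSeminorm_rieszPotential_le {d : ℕ} {α ε m : ℝ} (hd : 1 ≤ d) (hα : 0 < α) (hαd : α < d)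
    (hε : 0 < ε) (hm : 0 < m) (μ : Measure (Euc d))
    (hμ : morreyNorm d ((d : ℝ) - α) μ ≤ ENNReal.ofReal m) :
    bmoSeminorm d ((d : ℝ) - α + ε) Set.univ (rieszPotential d α μ) ≤
      ENNReal.ofReal (rieszBMOConst d α ε * m) := by
  have hp : 0 < (d : ℝ) - α := sub_pos.2 hαd
  have hd' : (0 : ℝ) < d := by exact_mod_cast hd
  have hγ := rieszConst_pos hα hαd
  refine iSup₂_le fun Q _ => ?_
  have hl := Q.side_pos
  set x₀ : Euc d := WithLp.toLp 2 Q.corner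
  obtain ⟨c, hc⟩ := abs_rieszPotential_sub_le hα hαd hm.le (ρ := d * Q.side) (by positivity) μ x₀
    fun r hr => measure_ball_le_of_morreyNorm_le hm.le hμ x₀ hr
  refine iInf_le_of_le c ?_
  have hlβ := Real.rpow_pos_of_pos hl ((d : ℝ) - α + ε)
  rw [ENNReal.div_le_iff (ENNReal.ofReal_pos.2 hlβ).ne' ENNReal.ofReal_ne_top,
    ← ENNReal.ofReal_mul (by have := rieszBMOConst_pos hd hα hαd hε; positivity)]
  set p : ℝ := (d : ℝ) - α with hpdef
  set γ : ℝ := rieszConst d α with hγdef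
  set R : ℝ := 4 * (d * Q.side) with hRdef
  have hR : 0 < R := by positivity
  have hω := omega_pos (add_pos hp hε)
  have hK := levelConst_pos hp hε
  have hQ : Q.set ⊆ Metric.ball x₀ R := fun x hx => by
    have h1 := Q.norm_sub_corner_le hx
    have h2 : 0 < d * Q.side := by positivity
    rw [Metric.mem_ball, dist_eq_norm]
    exact h1.trans_lt (by linarith)
  have hmain := lintegral_Ioi_le_of_le_div_sq
    (F := fun t => hausdorffContent d (p + ε) {x | x ∈ Q.set ∧ t < |rieszPotential d α μ x - c|})
    (A := Real.pi ^ ((p + ε) / 2) / Real.Gamma ((p + ε) / 2 + 1) * R ^ (p + ε))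
    (B := levelConst p ε * R ^ (p + ε) * (2 ^ p * m) ^ 2 * (2 * γ⁻¹) ^ 2)
    (T := 2 * γ⁻¹ * (d * 2 ^ p * 2 ^ p) * m) (by positivity) (by positivity) (by positivity)
    (fun t => (hausdorffContent_mono fun x hx => hQ hx.1).trans
      (hausdorffContent_ball_le (add_pos hp hε) x₀ R)) ?_
  · refine hmain.trans_eq ?_
    congr 1
    have h4 : R = 4 * d * Q.side := by rw [hRdef]; ring
    rw [rieszBMOConst, ← hpdef, ← hγdef, h4, Real.mul_rpow (by positivity) hl.le]
    field_simp
  · intro t ht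
    have ht0 : 0 < t := lt_trans (by positivity) ht
    have hlev := hausdorffContent_level_le hp hε (m := 2 ^ p * m) (t := γ * t / 2) (by positivity)
      hR (by positivity) μ x₀ fun x r hr => measure_closedBall_le_of_morreyNorm_le hm.le hμ x hr
    refine (hausdorffContent_mono ?_).trans (hlev.trans_eq ?_)
    · intro x hx
      refine ⟨hQ hx.1, ?_⟩
      by_contra! hcon
      have h1 := (hc x (Q.norm_sub_corner_le hx.1)).trans (add_le_add_left hcon _)
      rw [← ENNReal.ofReal_add (by positivity) (by positivity),
        ENNReal.ofReal_le_ofReal_iff (by positivity)] at h1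
      have h2 : γ * t < γ * |rieszPotential d α μ x - c| := by
        gcongr
        exact hx.2
      have h3 : d * 2 ^ p * 2 ^ p * m < γ * t / 2 := by
        calc d * 2 ^ p * 2 ^ p * m = γ * (2 * γ⁻¹ * (d * 2 ^ p * 2 ^ p) * m) / 2 := by
              field_simp
          _ < γ * t / 2 := by gcongr
      linarith
    · congr 1
      field_simp

theorem riesz_potential_morrey_bmo (d : ℕ) (hd : 1 ≤ d) (α ε : ℝ) (hα : 0 < α)
    (hαd : α < (d : ℝ)) (hε : 0 < ε) (hεα : ε ≤ α) :
    ∃ C : ℝ, 0 < C ∧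
      ∀ μ : Measure (Euc d), IsLocallyFiniteMeasure μ →
        morreyNorm d ((d : ℝ) - α) μ < ⊤ →
        (∀ K : Set (Euc d), IsCompact K →
          MemChoquetL1 (hausdorffContent d ((d : ℝ) - α + ε)) K (rieszPotential d α μ)) →
        bmoSeminorm d ((d : ℝ) - α + ε) Set.univ (rieszPotential d α μ) ≤
          ENNReal.ofReal C * morreyNorm d ((d : ℝ) - α) μ := by
  refine ⟨rieszBMOConst d α ε, rieszBMOConst_pos hd hα hαd hε, fun μ _ hμ _ => ?_⟩
  have hC := rieszBMOConst_pos hd hα hαd hε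
  rcases eq_or_ne (morreyNorm d ((d : ℝ) - α) μ) 0 with h0 | h0
  · rw [h0, mul_zero]
    refine ENNReal.le_of_forall_pos_le_add fun δ hδ _ => ?_
    refine (bmoSeminorm_rieszPotential_le hd hα hαd hε
      (div_pos (NNReal.coe_pos.2 hδ) hC) μ (by simp [h0])).trans ?_
    rw [mul_div_cancel₀ _ hC.ne', ENNReal.ofReal_coe_nnreal, zero_add]
  · refine (bmoSeminorm_rieszPotential_le hd hα hαd hε (ENNReal.toReal_pos h0 hμ.ne) μ
      (ENNReal.ofReal_toReal hμ.ne).ge).trans_eq ?_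
    rw [ENNReal.ofReal_mul hC.le, ENNReal.ofReal_toReal hμ.ne]

end
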